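/- Let F = F(X) be a free group on a set X with at least two elements, and let φ be an automorphism of F that is virtually inner. Let n be the least positive integer such that φⁿ is an inner automorphism, and let w₀ ∈ F be the element with φⁿ(x) = w₀ x w₀⁻¹ for all x ∈ F. Then the center of the group F_φ(X) = ⟨X, t ‖ t⁻¹ x t = φ(x), x ∈ X⟩, realized as the semidirect product F ⋊_φ ℤ in which the generator t of ℤ satisfies t⁻¹ x t = φ(x) for x ∈ F, is the infinite cyclic subgroup generated by the element tⁿ w₀. -/

import Mathlib

namespace FreeGroup

theorem center_eq_bot {X : Type*} [Nontrivial X] : Subgroup.center (FreeGroup X) = ⊥ := by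
  classical
  rw [eq_bot_iff]
  intro c hc
  rw [Subgroup.mem_bot]
  by_contra hne
  rw [Subgroup.mem_center_iff] at hc
  have hL : c.toWord ≠ [] := fun h => hne (toWord_eq_nil_iff.mp h)
  obtain ⟨a, L, ha⟩ := List.exists_cons_of_ne_nil hL
  obtain ⟨M, b, hb⟩ : ∃ M b, c.toWord = M ++ [b] :=
    ⟨_, _, (List.dropLast_append_getLast hL).symm⟩
  have hred : IsReduced c.toWord := isReduced_toWord
  obtain ⟨z, hz⟩ := exists_ne a.1
  have hleft : IsReduced ([(z, b.2)] ++ c.toWord) := by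
    rw [ha] at hred ⊢
    exact isReduced_cons_cons.mpr ⟨fun h => absurd h hz, hred⟩
  have hright : IsReduced (c.toWord ++ [(z, b.2)]) := by
    rw [hb] at hred ⊢
    refine hred.append_overlap ?_ (by simp)
    exact isReduced_cons_cons.mpr ⟨fun _ => rfl, .singleton⟩
  have h := congrArg toWord (hc (mk [(z, b.2)]))
  rw [toWord_mul, toWord_mul, toWord_mk, reduce_singleton, hleft.reduce_eq,
    hright.reduce_eq, ha] at h
  exact hz (congrArg Prod.fst (List.cons.inj h).1)

end FreeGroup

theorem MulAut.conj_injective_of_center_eq_bot {G : Type*} [Group G]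
    (hG : Subgroup.center G = ⊥) : Function.Injective (MulAut.conj : G →* MulAut G) := by
  rw [injective_iff_map_eq_one]
  intro g hg
  rw [← Subgroup.mem_bot, ← hG, Subgroup.mem_center_iff]
  intro x
  have := DFunLike.congr_fun hg x
  rw [MulAut.conj_apply, MulAut.one_apply] at this
  exact (mul_inv_eq_iff_eq_mul.mp this).symm

theorem SemidirectProduct.mem_center_zpowersHom_inv_iff {G : Type*} [Group G]
    (hG : Subgroup.center G = ⊥) (φ : MulAut G)
    (z : G ⋊[zpowersHom (MulAut G) φ⁻¹] Multiplicative ℤ) :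
    z ∈ Subgroup.center (G ⋊[zpowersHom (MulAut G) φ⁻¹] Multiplicative ℤ) ↔
      φ ^ z.right.toAdd = MulAut.conj z.left := by
  rw [Subgroup.mem_center_iff]
  constructor
  · intro hz
    rw [← inv_inj, ← inv_zpow]
    ext x
    have h := congrArg SemidirectProduct.left (hz (.inl x))
    simp only [mul_left, left_inl, right_inl, map_one, MulAut.one_apply,
      zpowersHom_apply] at h
    rw [← map_inv, MulAut.conj_apply, inv_inv, mul_assoc, h, inv_mul_cancel_left]
  · intro h g
    have hfix (ψ : MulAut G) (hψ : Commute ψ φ) : ψ z.left = z.left := by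
      apply MulAut.conj_injective_of_center_eq_bot hG
      have hconj : MulAut.conj (ψ z.left) = ψ * MulAut.conj z.left * ψ⁻¹ := by
        ext x
        simp
      rw [hconj, ← h, (hψ.zpow_right _).eq, mul_inv_cancel_right]
    ext
    · have hψ : Commute (φ⁻¹ ^ g.right.toAdd) φ := ((Commute.refl φ).inv_left).zpow_left _
      simp only [mul_left, zpowersHom_apply]
      rw [hfix _ hψ, inv_zpow, h, ← map_inv, MulAut.conj_apply]
      group
    · simp [mul_comm]

theorem MulAut.dvd_of_zpow_eq_conj {G : Type*} [Group G] {φ : MulAut G} {n : ℕ} (hn : 0 < n)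
    {w : G} (hw : φ ^ n = MulAut.conj w)
    (hleast : ∀ k : ℕ, 0 < k → k < n → ¬∃ v : G, φ ^ k = MulAut.conj v)
    {k : ℤ} {v : G} (hv : φ ^ k = MulAut.conj v) : (n : ℤ) ∣ k := by
  have hn' : (0 : ℤ) < n := by exact_mod_cast hn
  have hr : φ ^ (k % n) = MulAut.conj (v * (w ^ (k / n))⁻¹) := by
    rw [Int.emod_def, zpow_sub, zpow_mul, zpow_natCast, hv, hw]
    simp
  rw [Int.dvd_iff_emod_eq_zero]
  by_contra hne
  have h0 := Int.emod_nonneg k hn'.ne'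
  have hlt := Int.emod_lt_of_pos k hn'
  lift k % n to ℕ using h0 with r
  exact hleast r (by omega) (by omega) ⟨_, by rwa [zpow_natCast] at hr⟩


/-- **Proposition 1.** Let `F(X)` be a free group on a set `X` with at least two
elements and `φ` a virtually inner automorphism of `F(X)`, with `n` the least positive
integer such that `φⁿ` is inner, say `φⁿ(x) = w₀ x w₀⁻¹`.  Then the center of
`F_φ(X) = ⟨X, t ‖ t⁻¹ x t = φ(x)⟩`, realized as the semidirect product `F(X) ⋊ ℤ`
in which the generator `t = inr (ofAdd 1)` satisfies `t⁻¹ x t = φ(x)` (in Mathlib's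
convention conjugation by `inr g` is the action of `g`, so the action homomorphism
sends the generator to `φ⁻¹`), is the infinite cyclic subgroup generated by `tⁿ w₀`. -/
theorem center_hnn_virtually_inner {X : Type*} (x₀ y₀ : X) (hxy : x₀ ≠ y₀)
    (φ : MulAut (FreeGroup X)) (n : ℕ) (hn : 0 < n) (w₀ : FreeGroup X)
    (hφn : ∀ x : FreeGroup X, (φ ^ n) x = w₀ * x * w₀⁻¹)
    (hleast : ∀ k : ℕ, 0 < k → k < n →
      ¬∃ w : FreeGroup X, ∀ x : FreeGroup X, (φ ^ k) x = w * x * w⁻¹) :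
    Subgroup.center
        (FreeGroup X ⋊[zpowersHom (MulAut (FreeGroup X)) φ⁻¹] Multiplicative ℤ) =
      Subgroup.zpowers
        (SemidirectProduct.inr (Multiplicative.ofAdd (n : ℤ)) * SemidirectProduct.inl w₀) ∧
    ¬IsOfFinOrder
        (SemidirectProduct.inr (Multiplicative.ofAdd (n : ℤ)) *
          SemidirectProduct.inl w₀ :
          FreeGroup X ⋊[zpowersHom (MulAut (FreeGroup X)) φ⁻¹] Multiplicative ℤ) := by
  have : Nontrivial X := ⟨x₀, y₀, hxy⟩
  have hcenter := FreeGroup.center_eq_bot (X := X)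
  have hconj (k : ℕ) (w : FreeGroup X) :
      φ ^ k = MulAut.conj w ↔ ∀ x : FreeGroup X, (φ ^ k) x = w * x * w⁻¹ := by
    simp only [MulEquiv.ext_iff, MulAut.conj_apply]
  have hw := (hconj n w₀).mpr hφn
  have hleft : (φ⁻¹ ^ n) w₀ = w₀ := by
    rw [inv_pow, hw, ← map_inv, MulAut.conj_apply]
    group
  set z : FreeGroup X ⋊[zpowersHom (MulAut (FreeGroup X)) φ⁻¹] Multiplicative ℤ :=
    SemidirectProduct.inr (Multiplicative.ofAdd (n : ℤ)) * SemidirectProduct.inl w₀ with hz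
  have hzleft : z.left = w₀ := by
    simpa [hz, zpowersHom_apply] using hleft
  have hzright (q : ℤ) : (z ^ q).right.toAdd = n * q := by
    rw [← SemidirectProduct.rightHom_eq_right, map_zpow, toAdd_zpow]
    simp [hz, mul_comm]
  have hzmem : z ∈ Subgroup.center _ := by
    rw [SemidirectProduct.mem_center_zpowersHom_inv_iff hcenter, hzleft, ← hw,
      ← zpow_natCast, ← mul_one (n : ℤ), ← hzright, zpow_one]
  refine ⟨le_antisymm (fun y hy => ?_) (Subgroup.zpowers_le.mpr hzmem), ?_⟩
  · have hy' := (SemidirectProduct.mem_center_zpowersHom_inv_iff hcenter φ y).mp hy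
    obtain ⟨q, hq⟩ := MulAut.dvd_of_zpow_eq_conj hn hw
      (fun k hk hkn h => hleast k hk hkn (h.imp fun v => (hconj k v).mp)) hy'
    have hq' := (SemidirectProduct.mem_center_zpowersHom_inv_iff hcenter φ _).mp
      (zpow_mem hzmem q)
    have hright : (z ^ q).right = y.right := Multiplicative.toAdd.injective
      ((hzright q).trans hq.symm)
    refine ⟨q, SemidirectProduct.ext ?_ hright⟩
    apply MulAut.conj_injective_of_center_eq_bot hcenter
    rw [← hy', ← hright, ← hq']
  · rw [isOfFinOrder_iff_pow_eq_one]
    rintro ⟨m, hm, h⟩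
    have h' := hzright m
    rw [zpow_natCast, h, SemidirectProduct.one_right, toAdd_one] at h'
    exact (mul_pos (Int.natCast_pos.mpr hn) (Int.natCast_pos.mpr hm)).ne h'
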